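/- Energy identity for solutions of the mean field equation (step in the proof of Theorem 1): assume A₀ = 1, let h : ℝ² → ℝ be smooth, positive and Λ-periodic, and let u : ℝ² → ℝ be smooth and Λ-periodic with Δ₀ u = 8π h e^u − 8π on ℝ². Then J(u) = (1/2) ∫_F u(q) (h(q) e^{u(q)} + 1) dq, where J(u) = (1/(16π)) ∫_F ‖∇u(q)‖² dq + ∫_F u(q) dq − log(∫_F h(q) e^{u(q)} dq). -/

import Mathlib

open Real MeasureTheory

noncomputable section

/-- The plane `ℝ²`. -/
abbrev V : Type := EuclideanSpace ℝ (Fin 2)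

/-- `f` is `Λ`-periodic for the lattice `Λ = ℤv₁ + ℤv₂`. -/
def IsPeriodic (v₁ v₂ : V) (f : V → ℝ) : Prop :=
  ∀ x : V, ∀ m n : ℤ, f (x + m • v₁ + n • v₂) = f x

/-- Membership in the lattice `Λ = ℤv₁ + ℤv₂`. -/
def InLattice (v₁ v₂ x : V) : Prop :=
  ∃ m n : ℤ, x = m • v₁ + n • v₂

/-- The fundamental domain `F = {s v₁ + t v₂ : s, t ∈ [0,1)}`. -/
def Fdom (v₁ v₂ : V) : Set V :=
  {x | ∃ s t : ℝ, 0 ≤ s ∧ s < 1 ∧ 0 ≤ t ∧ t < 1 ∧ x = s • v₁ + t • v₂}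

/-- The Euclidean area of the fundamental domain, `A₀ = |det (v₁ v₂)|`. -/
def A0 (v₁ v₂ : V) : ℝ := |v₁ 0 * v₂ 1 - v₁ 1 * v₂ 0|

/-- The geometer's flat Laplacian `Δ₀ f = −(∂²f/∂x₁² + ∂²f/∂x₂²)`. -/
def lap (f : V → ℝ) (p : V) : ℝ :=
  -(iteratedFDeriv ℝ 2 f p ![EuclideanSpace.single 0 1, EuclideanSpace.single 0 1]
    + iteratedFDeriv ℝ 2 f p ![EuclideanSpace.single 1 1, EuclideanSpace.single 1 1])

/-- Total area `A_φ = ∫_F e^φ dx` of the conformal metric `g_φ = e^φ (dx₁² + dx₂²)`. -/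
def Aphi (v₁ v₂ : V) (φ : V → ℝ) : ℝ := ∫ q in Fdom v₁ v₂, Real.exp (φ q)

/-- `G` is a normalized Green's function for the conformal metric `g_φ`,
with Euclidean Robin function `mR`. -/
structure IsGreen (v₁ v₂ : V) (φ : V → ℝ) (G : V → V → ℝ) (mR : V → ℝ) : Prop where
  periodic_left : ∀ p q : V, ∀ m n : ℤ, G (p + m • v₁ + n • v₂) q = G p q
  periodic_right : ∀ p q : V, ∀ m n : ℤ, G p (q + m • v₁ + n • v₂) = G p q
  symm : ∀ p q : V, G p q = G q p
  smooth : ContDiffOn ℝ (⊤ : ℕ∞) (fun x : V × V => G x.1 x.2)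
    {x : V × V | ¬ InLattice v₁ v₂ (x.1 - x.2)}
  zero_avg : ∀ p : V, ∫ q in Fdom v₁ v₂, G p q * Real.exp (φ q) = 0
  green_eq : ∀ f : V → ℝ, ContDiff ℝ (⊤ : ℕ∞) f → IsPeriodic v₁ v₂ f → ∀ p : V,
    ∫ q in Fdom v₁ v₂, G p q * lap f q
      = f p - (Aphi v₁ v₂ φ)⁻¹ * ∫ q in Fdom v₁ v₂, f q * Real.exp (φ q)
  robin_cont : Continuous mR
  robin_periodic : IsPeriodic v₁ v₂ mR
  robin : ∀ p : V, Filter.Tendsto (fun q : V => G p q - (1 / (2 * π)) * Real.log ‖q - p‖)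
    (nhdsWithin p {p}ᶜ) (nhds (mR p))

/-- `trace Δ_φ⁻¹ = ∫_F m_φ e^φ dq`, where the paper's Robin constant is
`m_φ = m̃_φ − φ/(4π)` in terms of the Euclidean Robin function `m̃_φ`. -/
def traceInv (v₁ v₂ : V) (φ mR : V → ℝ) : ℝ :=
  ∫ q in Fdom v₁ v₂, (mR q - φ q / (4 * π)) * Real.exp (φ q)

/-- The Ding–Jost–Li–Wang functional
`J(v) = (1/(16π)) ∫_F ‖∇v‖² + ∫_F v − log ∫_F h e^v`. -/
def Jfun (v₁ v₂ : V) (h v : V → ℝ) : ℝ :=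
  (1 / (16 * π)) * (∫ q in Fdom v₁ v₂, ‖fderiv ℝ v q‖ ^ 2)
    + (∫ q in Fdom v₁ v₂, v q)
    - Real.log (∫ q in Fdom v₁ v₂, h q * Real.exp (v q))

end

section helpers
open scoped Pointwise

lemma exists_basis_aux (v₁ v₂ : V) (hind : LinearIndependent ℝ ![v₁, v₂]) :
    ∃ b : Module.Basis (Fin 2) ℝ V, (⇑b = ![v₁, v₂]) ∧ Fdom v₁ v₂ = ZSpan.fundamentalDomain b := by
  refine ⟨basisOfLinearIndependentOfCardEqFinrank hind (by simp), by simp, ?_⟩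
  set b := basisOfLinearIndependentOfCardEqFinrank hind (by simp) with hb
  have hbv : ⇑b = ![v₁, v₂] := by simp [hb]
  have h0 : b 0 = v₁ := by simp [hbv]
  have h1 : b 1 = v₂ := by simp [hbv]
  ext x
  rw [ZSpan.mem_fundamentalDomain]
  constructor
  · rintro ⟨s, t, hs0, hs1, ht0, ht1, rfl⟩ i
    have : b.repr (s • v₁ + t • v₂) = Finsupp.single 0 s + Finsupp.single 1 t := by
      rw [← h0, ← h1]; simp
    rw [this]
    fin_cases i <;> simp [*]
  · intro hx
    refine ⟨b.repr x 0, b.repr x 1, (hx 0).1, (hx 0).2, (hx 1).1, (hx 1).2, ?_⟩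
    have := b.sum_repr x
    rw [Fin.sum_univ_two, h0, h1] at this
    exact this.symm

lemma measurableSet_Fdom (v₁ v₂ : V) (hind : LinearIndependent ℝ ![v₁, v₂]) :
    MeasurableSet (Fdom v₁ v₂) := by
  obtain ⟨b, -, hF⟩ := exists_basis_aux v₁ v₂ hind
  rw [hF]; exact ZSpan.fundamentalDomain_measurableSet b

lemma bdd_Fdom (v₁ v₂ : V) (hind : LinearIndependent ℝ ![v₁, v₂]) :
    ∃ R : ℝ, Fdom v₁ v₂ ⊆ Metric.closedBall 0 R := by
  obtain ⟨b, -, hF⟩ := exists_basis_aux v₁ v₂ hind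
  rw [hF]; exact (ZSpan.fundamentalDomain_isBounded b).subset_closedBall 0

lemma integrableOn_Fdom (v₁ v₂ : V) (hind : LinearIndependent ℝ ![v₁, v₂])
    (g : V → ℝ) (hg : Continuous g) : IntegrableOn g (Fdom v₁ v₂) := by
  obtain ⟨R, hR⟩ := bdd_Fdom v₁ v₂ hind
  exact (hg.continuousOn.integrableOn_compact (isCompact_closedBall (0 : V) R)).mono_set hR

lemma volume_Fdom (v₁ v₂ : V) (hind : LinearIndependent ℝ ![v₁, v₂]) :
    volume.real (Fdom v₁ v₂) = A0 v₁ v₂ := by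
  obtain ⟨b, hb, hF⟩ := exists_basis_aux v₁ v₂ hind
  let e := EuclideanSpace.basisFun (Fin 2) ℝ
  rw [hF, ZSpan.measureReal_fundamentalDomain b volume e.toBasis]
  have h1 : volume.real (ZSpan.fundamentalDomain e.toBasis) = 1 := by
    rw [measureReal_def, measure_congr (ZSpan.fundamentalDomain_ae_parallelepiped e.toBasis volume)]
    have := e.volume_parallelepiped
    simp [this]
  rw [h1, mul_one, Module.Basis.det_apply, Matrix.det_fin_two, hb]
  simp [Module.Basis.toMatrix_apply, A0, e]
  congr 1
  ring

lemma integral_translate (v₁ v₂ : V) (hind : LinearIndependent ℝ ![v₁, v₂])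
    (g : V → ℝ) (hg : IsPeriodic v₁ v₂ g) (w : V) :
    ∫ x in Fdom v₁ v₂, g (x + w) = ∫ x in Fdom v₁ v₂, g x := by
  obtain ⟨b, hb, hF⟩ := exists_basis_aux v₁ v₂ hind
  rw [hF]
  have hd := ZSpan.isAddFundamentalDomain' b (volume : Measure V)
  have hd2 : IsAddFundamentalDomain (Submodule.span ℤ (Set.range b)).toAddSubgroup
      (w +ᵥ ZSpan.fundamentalDomain b) volume := hd.vadd_of_comm w
  have hinv : ∀ (l : (Submodule.span ℤ (Set.range b)).toAddSubgroup) (x : V),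
      g (l +ᵥ x) = g x := by
    rintro ⟨l, hl⟩ x
    have hl' : l ∈ Submodule.span ℤ {v₁, v₂} := by
      have : Set.range b = {v₁, v₂} := by rw [hb]; simp [Matrix.range_cons, Set.pair_comm]
      rw [← this]; exact hl
    obtain ⟨m, n, rfl⟩ := Submodule.mem_span_pair.1 hl'
    have := hg x m n
    rw [← this]
    congr 1
    change (m • v₁ + n • v₂) + x = _
    abel
  have : Countable (Submodule.span ℤ (Set.range b)).toAddSubgroup :=
    inferInstanceAs (Countable (Submodule.span ℤ (Set.range b)))
  rw [hd.setIntegral_eq hd2 hinv]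
  have hm : MeasurePreserving (fun x : V => w + x) volume volume := measurePreserving_add_left _ w
  have := hm.setIntegral_image_emb (MeasurableEquiv.addLeft w).measurableEmbedding g
    (ZSpan.fundamentalDomain b)
  rw [← Set.image_vadd]
  simp only [vadd_eq_add]
  rw [this]
  simp only [add_comm]

lemma integral_fderiv_eq_zero (v₁ v₂ : V) (hind : LinearIndependent ℝ ![v₁, v₂])
    (g : V → ℝ) (hc : ContDiff ℝ 1 g) (hg : IsPeriodic v₁ v₂ g) (w : V) :
    ∫ x in Fdom v₁ v₂, fderiv ℝ g x w = 0 := by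
  obtain ⟨R, hR⟩ := bdd_Fdom v₁ v₂ hind
  have hcd : Continuous (fun x => fderiv ℝ g x w) :=
    (hc.continuous_fderiv (by simp)).clm_apply continuous_const
  obtain ⟨C, hC⟩ := (isCompact_closedBall (0 : V) (R + ‖w‖)).exists_bound_of_continuousOn
    hcd.continuousOn
  have hms := measurableSet_Fdom v₁ v₂ hind
  have key := hasDerivAt_integral_of_dominated_loc_of_deriv_le
    (μ := volume.restrict (Fdom v₁ v₂)) (F := fun (t : ℝ) x => g (x + t • w))
    (F' := fun (t : ℝ) x => fderiv ℝ g (x + t • w) w) (x₀ := (0 : ℝ))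
    (s := Metric.ball 0 1) (bound := fun _ => C)
    (Metric.ball_mem_nhds _ one_pos)
    (Filter.Eventually.of_forall fun t =>
      (hc.continuous.comp (by fun_prop : Continuous fun x : V => x + t • w)).aestronglyMeasurable)
    (integrableOn_Fdom v₁ v₂ hind _
      (hc.continuous.comp (by fun_prop : Continuous fun x : V => x + (0 : ℝ) • w)))
    (hcd.comp (by fun_prop : Continuous fun x : V => x + (0 : ℝ) • w)).aestronglyMeasurable
    (by
      filter_upwards [ae_restrict_mem hms] with x hx t ht
      apply hC
      have h1 := hR hx
      rw [mem_closedBall_zero_iff] at h1 ⊢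
      rw [mem_ball_zero_iff] at ht
      calc ‖x + t • w‖ ≤ ‖x‖ + ‖t • w‖ := norm_add_le _ _
        _ ≤ R + 1 * ‖w‖ := by rw [norm_smul]; gcongr
        _ = _ := by ring)
    (integrableOn_Fdom v₁ v₂ hind _ continuous_const)
    (by
      refine Filter.Eventually.of_forall fun x t _ => ?_
      have h1 : HasDerivAt (fun t : ℝ => x + t • w) w t := by
        simpa using ((hasDerivAt_id t).smul_const w).const_add x
      exact ((hc.differentiable (by simp)) (x + t • w)).hasFDerivAt.comp_hasDerivAt t h1)
  have h2 := key.2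
  simp only [integral_translate v₁ v₂ hind g hg] at h2
  have h3 := h2.unique (hasDerivAt_const _ _)
  simpa using h3

lemma periodic_fderiv (v₁ v₂ : V) (g : V → ℝ) (hg : IsPeriodic v₁ v₂ g) (w : V) :
    IsPeriodic v₁ v₂ (fun x => fderiv ℝ g x w) := by
  intro x m n
  have : (fun y => g (y + (m • v₁ + n • v₂))) = g := by
    ext y; rw [← add_assoc]; exact hg y m n
  have h2 := fderiv_comp_add_right (𝕜 := ℝ) (f := g) (x := x) (m • v₁ + n • v₂)
  rw [this] at h2
  simp only [add_assoc]
  rw [h2]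

lemma norm_fderiv_sq (L : V →L[ℝ] ℝ) :
    ‖L‖ ^ 2 = L (EuclideanSpace.single 0 1) ^ 2 + L (EuclideanSpace.single 1 1) ^ 2 := by
  have := (EuclideanSpace.basisFun (Fin 2) ℝ).norm_dual L
  rw [this]
  simp [Fin.sum_univ_two]

end helpers

/-- **Energy identity for mean-field solutions.** On a unit-area flat torus, any smooth
periodic solution of `Δ₀ u = 8π h e^u − 8π` satisfies `J(u) = (1/2) ∫_F u (h e^u + 1)`. -/
theorem mean_field_energy (v₁ v₂ : V) (hind : LinearIndependent ℝ ![v₁, v₂])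
    (hA₀ : A0 v₁ v₂ = 1)
    (h : V → ℝ) (hh : ContDiff ℝ (⊤ : ℕ∞) h) (hpos : ∀ x, 0 < h x) (hhper : IsPeriodic v₁ v₂ h)
    (u : V → ℝ) (hu : ContDiff ℝ (⊤ : ℕ∞) u) (huper : IsPeriodic v₁ v₂ u)
    (heq : ∀ p : V, lap u p = 8 * π * h p * Real.exp (u p) - 8 * π) :
    Jfun v₁ v₂ h u
      = (1 / 2) * ∫ q in Fdom v₁ v₂, u q * (h q * Real.exp (u q) + 1) := by
  have hu2 : ContDiff ℝ 2 u := contDiff_infty.1 hu 2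
  have hd : ∀ w : V, ContDiff ℝ 1 (fun x => fderiv ℝ u x w) := fun w =>
    (hu2.fderiv_right (m := 1) (by norm_num)).clm_apply contDiff_const
  have hu1 : ContDiff ℝ 1 u := hu2.of_le (by norm_num)
  have hdd : ∀ w x, fderiv ℝ (fun y => fderiv ℝ u y w) x w = iteratedFDeriv ℝ 2 u x ![w, w] := by
    intro w x
    rw [iteratedFDeriv_two_apply, fderiv_clm_apply]
    · simp
    · exact ((hu2.fderiv_right (m := 1) (by norm_num)).differentiable (by simp)) x
    · exact differentiableAt_const _
  have hddc : ∀ w, Continuous fun x => iteratedFDeriv ℝ 2 u x ![w, w] := by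
    intro w
    simp only [← hdd]
    exact ((hd w).continuous_fderiv (by simp)).clm_apply continuous_const
  have hI := integrableOn_Fdom v₁ v₂ hind
  have hA : ∀ w, ∫ x in Fdom v₁ v₂, iteratedFDeriv ℝ 2 u x ![w, w] = 0 := by
    intro w
    simp only [← hdd]
    exact integral_fderiv_eq_zero v₁ v₂ hind _ (hd w) (periodic_fderiv v₁ v₂ u huper w) w
  have hB : ∀ w, ∫ x in Fdom v₁ v₂, ((fderiv ℝ u x w) ^ 2
      + u x * iteratedFDeriv ℝ 2 u x ![w, w]) = 0 := by
    intro w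
    have := integral_fderiv_eq_zero v₁ v₂ hind (fun x => u x * fderiv ℝ u x w)
      (hu1.mul (hd w)) (fun x m n => by
        have h1 := huper x m n
        have h2 := periodic_fderiv v₁ v₂ u huper w x m n
        simp only at h2 ⊢
        rw [h1, h2]) w
    rw [← this]
    congr 1
    ext x
    rw [fderiv_fun_mul (hu1.differentiable (by simp) x) ((hd w).differentiable (by simp) x)]
    simp [hdd]
    ring
  have hcu := hu.continuous
  have hch := hh.continuous
  have hdc : ∀ w, Continuous (fun x => fderiv ℝ u x w) := fun w => (hd w).continuous
  -- total mass
  have hmass : ∫ q in Fdom v₁ v₂, h q * Real.exp (u q) = 1 := by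
    have h1 : ∫ x in Fdom v₁ v₂, lap u x = 0 := by
      unfold lap
      rw [integral_neg, integral_add (hI _ (hddc _)) (hI _ (hddc _)), hA, hA]
      simp
    have h2 : ∫ x in Fdom v₁ v₂, lap u x
        = 8 * π * (∫ q in Fdom v₁ v₂, h q * Real.exp (u q)) - 8 * π := by
      simp only [heq, mul_assoc]
      rw [integral_sub (hI _ (by fun_prop)) (hI _ (by fun_prop)), setIntegral_const,
        volume_Fdom v₁ v₂ hind, hA₀]
      simp only [integral_const_mul, one_smul]
    have hpi := Real.pi_pos
    have h3 : 8 * π * ((∫ q in Fdom v₁ v₂, h q * Real.exp (u q)) - 1) = 0 := by linarith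
    rcases mul_eq_zero.1 h3 with h4 | h4
    · linarith
    · linarith
  have hgrad : ∫ q in Fdom v₁ v₂, ‖fderiv ℝ u q‖ ^ 2
      = 8 * π * (∫ q in Fdom v₁ v₂, u q * (h q * Real.exp (u q)))
        - 8 * π * ∫ q in Fdom v₁ v₂, u q := by
    have h1 := hB (EuclideanSpace.single 0 1)
    have h2 := hB (EuclideanSpace.single 1 1)
    have hBc : ∀ w, Continuous fun x => (fderiv ℝ u x w) ^ 2
        + u x * iteratedFDeriv ℝ 2 u x ![w, w] := fun w =>
      ((hdc w).pow 2).add (hcu.mul (hddc w))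
    have h3 : ∫ q in Fdom v₁ v₂, (‖fderiv ℝ u q‖ ^ 2 - u q * lap u q) = 0 := by
      rw [← add_zero (0 : ℝ)]
      nth_rewrite 1 [← h1]
      rw [← h2, ← integral_add (hI _ (hBc _)) (hI _ (hBc _))]
      congr 1
      ext x
      rw [norm_fderiv_sq, lap]
      ring
    have hnc : Continuous fun q => ‖fderiv ℝ u q‖ ^ 2 :=
      ((hu1.continuous_fderiv (by simp)).norm.pow 2)
    simp only [heq] at h3
    rw [integral_sub (hI _ hnc) (hI _ (by fun_prop))] at h3
    have h4 : ∫ q in Fdom v₁ v₂, u q * (8 * π * h q * Real.exp (u q) - 8 * π)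
        = 8 * π * (∫ q in Fdom v₁ v₂, u q * (h q * Real.exp (u q)))
        - 8 * π * ∫ q in Fdom v₁ v₂, u q := by
      rw [← integral_const_mul, ← integral_const_mul,
        ← integral_sub (hI _ (by fun_prop)) (hI _ (by fun_prop))]
      congr 1
      ext x
      ring
    linarith
  have hR : ∫ q in Fdom v₁ v₂, u q * (h q * Real.exp (u q) + 1)
      = (∫ q in Fdom v₁ v₂, u q * (h q * Real.exp (u q))) + ∫ q in Fdom v₁ v₂, u q := by
    rw [← integral_add (hI _ (by fun_prop)) (hI _ (by fun_prop))]
    congr 1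
    ext x
    ring
  rw [Jfun, hgrad, hmass, hR, Real.log_one]
  have hpi := Real.pi_ne_zero
  field_simp
  ring
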